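/- Assume that X̄_∞ := sup_{t ≥ 0} X_t < ∞ almost surely. Then for every β ≥ 0 and x ≥ 0, E[e^{−β X_{τ_x^+}} 1_{{τ_x^+ < ∞}}] = E[e^{−β X̄_∞} 1_{{X̄_∞ > x}}] / E[e^{−β X̄_∞}]. -/

import Mathlib

open MeasureTheory ProbabilityTheory Set Filter
open scoped ENNReal NNReal Classical

noncomputable section

namespace AKLevy

variable {Ω : Type*}

/-- Running supremum `X̄_t = sup_{0 ≤ s ≤ t} X_s` of a process. -/
def runSup (X : ℝ → Ω → ℝ) (t : ℝ) (ω : Ω) : ℝ :=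
  sSup ((fun s => X s ω) '' Set.Icc 0 t)

/-- Running infimum `X̲_t = inf_{0 ≤ s ≤ t} X_s` of a process. -/
def runInf (X : ℝ → Ω → ℝ) (t : ℝ) (ω : Ω) : ℝ :=
  sInf ((fun s => X s ω) '' Set.Icc 0 t)

/-- All-time supremum `X̄_∞ = sup_{t ≥ 0} X_t`. -/
def supAll (X : ℝ → Ω → ℝ) (ω : Ω) : ℝ :=
  sSup ((fun s => X s ω) '' Set.Ici 0)

/-- All-time infimum `X̲_∞ = inf_{t ≥ 0} X_t`. -/
def infAll (X : ℝ → Ω → ℝ) (ω : Ω) : ℝ :=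
  sInf ((fun s => X s ω) '' Set.Ici 0)

/-- `X` is a real-valued Lévy process with respect to the filtration `ℱ`,
on a filtered probability space satisfying the usual conditions. -/
structure IsLevy [m0 : MeasurableSpace Ω] (P : Measure Ω) (ℱ : Filtration ℝ m0)
    (X : ℝ → Ω → ℝ) : Prop where
  isProb : IsProbabilityMeasure P
  adapted : ∀ t : ℝ, 0 ≤ t → StronglyMeasurable[ℱ t] (X t)
  zero : ∀ᵐ ω ∂P, X 0 ω = 0
  rightCont : ∀ ω, ∀ t : ℝ, 0 ≤ t → ContinuousWithinAt (fun s => X s ω) (Set.Ici t) t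
  leftLim : ∀ ω, ∀ t : ℝ, 0 < t →
    ∃ l : ℝ, Tendsto (fun s => X s ω) (nhdsWithin t (Set.Iio t)) (nhds l)
  indepIncrements : ∀ s t : ℝ, 0 ≤ s → s ≤ t →
    Indep (MeasurableSpace.comap (fun ω => X t ω - X s ω) inferInstance) (ℱ s) P
  stationary : ∀ s t : ℝ, 0 ≤ s → s ≤ t →
    Measure.map (fun ω => X t ω - X s ω) P = Measure.map (X (t - s)) P
  filtRightCont : ∀ t : ℝ, (ℱ t : MeasurableSpace Ω) = ⨅ s ∈ Set.Ioi t, (ℱ s : MeasurableSpace Ω)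
  complete : ∀ N : Set Ω, MeasurableSet N → P N = 0 → MeasurableSet[ℱ 0] N

/-- `τ_x^+ < ∞`: the process passes strictly above level `x` at some nonnegative time. -/
def hitsAbove (X : ℝ → Ω → ℝ) (x : ℝ) (ω : Ω) : Prop := ∃ t, 0 ≤ t ∧ x < X t ω

/-- First passage time above `x`:  `τ_x^+ = inf {t ≥ 0 : X_t > x}` (junk value if never). -/
def tauAbove (X : ℝ → Ω → ℝ) (x : ℝ) (ω : Ω) : ℝ := sInf {t : ℝ | 0 ≤ t ∧ x < X t ω}

/-- `τ_x^- < ∞`: the process passes strictly below level `x` at some nonnegative time. -/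
def hitsBelow (X : ℝ → Ω → ℝ) (x : ℝ) (ω : Ω) : Prop := ∃ t, 0 ≤ t ∧ X t ω < x

/-- First passage time below `x`:  `τ_x^- = inf {t ≥ 0 : X_t < x}` (junk value if never). -/
def tauBelow (X : ℝ → Ω → ℝ) (x : ℝ) (ω : Ω) : ℝ := sInf {t : ℝ | 0 ≤ t ∧ X t ω < x}

/-- The `[0,∞]`-valued first passage time `σ_x = inf { t ≥ 0 : x + X_t < y }`, with `inf ∅ = ∞`. -/
def hitBelowE (X : ℝ → Ω → ℝ) (y x : ℝ) (ω : Ω) : ℝ≥0∞ :=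
  if ∃ t, 0 ≤ t ∧ x + X t ω < y then ENNReal.ofReal (sInf {t : ℝ | 0 ≤ t ∧ x + X t ω < y})
  else ∞

/-- The stopped clock `t ∧ σ_x` (real-valued), where `σ_x = inf{ t ≥ 0 : x + X_t < y}`. -/
def stoppedClock (X : ℝ → Ω → ℝ) (y x : ℝ) (t : ℝ) (ω : Ω) : ℝ :=
  (min (ENNReal.ofReal t) (hitBelowE X y x ω)).toReal

/-- A `[0,∞]`-valued stopping time of the filtration `ℱ`. -/
def IsStopTime [m0 : MeasurableSpace Ω] (ℱ : Filtration ℝ m0) (τ : Ω → ℝ≥0∞) : Prop :=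
  ∀ t : ℝ, 0 ≤ t → MeasurableSet[ℱ t] {ω | τ ω ≤ ENNReal.ofReal t}

/-- Discounted payoff `e^{-rτ} G(x + X_τ)` at a `[0,∞]`-valued time `τ`, set to `0` on `{τ = ∞}`. -/
def stopPayoff (X : ℝ → Ω → ℝ) (r x : ℝ) (G : ℝ → ℝ) (τ : Ω → ℝ≥0∞) (ω : Ω) : ℝ :=
  if τ ω ≠ ∞ then Real.exp (-(r * (τ ω).toReal)) * G (x + X ((τ ω).toReal) ω) else 0

/-- Discounted American put payoff `e^{-rτ}(K - e^{x + X_τ})^+ 1_{τ < ∞}`. -/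
def putPayoff (X : ℝ → Ω → ℝ) (r K x : ℝ) (τ : Ω → ℝ≥0∞) (ω : Ω) : ℝ :=
  stopPayoff X r x (fun z => max (K - Real.exp z) 0) τ ω

/-- Value function `v(x) = sup_τ E[e^{-rτ}(K - e^{x+X_τ})^+ 1_{τ<∞}]`, the supremum
being over all `[0,∞]`-valued stopping times of `ℱ`. -/
def putValue [m0 : MeasurableSpace Ω] (P : Measure Ω) (ℱ : Filtration ℝ m0)
    (X : ℝ → Ω → ℝ) (r K x : ℝ) : ℝ :=
  ⨆ τ : {τ : Ω → ℝ≥0∞ // IsStopTime ℱ τ}, ∫ ω, putPayoff X r K x τ.1 ω ∂P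

/-- `m = E[e^{X̲_{e_r}}]`, where `e_r` is an independent exponential time of rate `r > 0`,
and `e_0 = ∞`. -/
def mInf [m0 : MeasurableSpace Ω] (P : Measure Ω) (X : ℝ → Ω → ℝ) (r : ℝ) : ℝ :=
  if 0 < r then
    ∫ t in Set.Ioi (0 : ℝ), r * Real.exp (-(r * t)) * (∫ ω, Real.exp (runInf X t ω) ∂P)
  else ∫ ω, Real.exp (infAll X ω) ∂P

/-- `P(X̲_{e_r} = 0)`, where `e_r` is an independent exponential time of rate `r > 0`,
and `e_0 = ∞`. -/
def atomZeroProb [m0 : MeasurableSpace Ω] (P : Measure Ω) (X : ℝ → Ω → ℝ) (r : ℝ) : ℝ :=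
  if 0 < r then
    ∫ t in Set.Ioi (0 : ℝ), r * Real.exp (-(r * t)) * (P {ω | runInf X t ω = 0}).toReal
  else (P {ω | infAll X ω = 0}).toReal

/-- The event `{τ_0^- = 0}`: `0` is (pathwise) immediately reached from below, i.e.
`inf{t ≥ 0 : X_t < 0} = 0`. -/
def regularBelow (X : ℝ → Ω → ℝ) : Set Ω :=
  {ω | ∀ ε > (0 : ℝ), ∃ t, 0 ≤ t ∧ t < ε ∧ X t ω < 0}

/-- `E[e^{-γ X̄_{e_α}}] = ∫_0^∞ α e^{-α t} E[e^{-γ X̄_t}] dt`. -/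
def expSupLT [m0 : MeasurableSpace Ω] (P : Measure Ω) (X : ℝ → Ω → ℝ) (α γ : ℝ) : ℝ :=
  ∫ t in Set.Ioi (0 : ℝ), α * Real.exp (-(α * t)) * (∫ ω, Real.exp (-(γ * runSup X t ω)) ∂P)

/-- The function `h_{α,β}(x) = E[e^{-α σ_x + β (x + X_{σ_x})} 1_{σ_x < ∞}]`, where
`σ_x = inf{t ≥ 0 : x + X_t < 0}`. -/
def hAB [m0 : MeasurableSpace Ω] (P : Measure Ω) (X : ℝ → Ω → ℝ) (α β : ℝ) (z : ℝ) : ℝ :=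
  ∫ ω, (if hitsBelow X (-z) ω then
      Real.exp (-(α * tauBelow X (-z) ω) + β * (z + X (tauBelow X (-z) ω) ω)) else 0) ∂P

/-- `v_y(x) = E[e^{-r σ_x} (K - e^{x + X_{σ_x}})^+ 1_{σ_x<∞}]` where
`σ_x = inf{t ≥ 0 : x + X_t < y}`. -/
def vy [m0 : MeasurableSpace Ω] (P : Measure Ω) (X : ℝ → Ω → ℝ) (r K y : ℝ) (z : ℝ) : ℝ :=
  ∫ ω, putPayoff X r K z (hitBelowE X y z) ω ∂P

/-- The process `f` (indexed by `t ≥ 0`) is a martingale with respect to `ℱ` and `P`. -/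
def MartOn [m0 : MeasurableSpace Ω] (P : Measure Ω) (ℱ : Filtration ℝ m0)
    (f : ℝ → Ω → ℝ) : Prop :=
  (∀ t : ℝ, 0 ≤ t → StronglyMeasurable[ℱ t] (f t)) ∧
  (∀ t : ℝ, 0 ≤ t → Integrable (f t) P) ∧
  ∀ s t : ℝ, 0 ≤ s → s ≤ t → P[f t|ℱ s] =ᵐ[P] f s

/-- The process `f` (indexed by `t ≥ 0`) is a supermartingale w.r.t. `ℱ` and `P`. -/
def SupermartOn [m0 : MeasurableSpace Ω] (P : Measure Ω) (ℱ : Filtration ℝ m0)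
    (f : ℝ → Ω → ℝ) : Prop :=
  (∀ t : ℝ, 0 ≤ t → StronglyMeasurable[ℱ t] (f t)) ∧
  (∀ t : ℝ, 0 ≤ t → Integrable (f t) P) ∧
  ∀ s t : ℝ, 0 ≤ s → s ≤ t → P[f t|ℱ s] ≤ᵐ[P] f s

/-- Supremum of the path `f` over `[t, ∞)`. -/
def tailSup (f : ℝ → ℝ) (t : ℝ) : ℝ := sSup (f '' Ici t)

/-- Maximum over `0 ≤ k ≤ n` of `f (t + k h) - f t`, computed recursively in `n`. -/
def gridMax (f : ℝ → ℝ) (h : ℝ) : ℕ → ℝ → ℝ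
  | 0, _ => 0
  | n + 1, t => max 0 (f (t + h) - f t + gridMax f h n (t + h))

/-- The smallest point of the grid `(j + 1)⁻¹ ℕ` strictly above `r`. -/
def gridNext (j : ℕ) (r : ℝ) : ℝ := ((⌊r * (j + 1)⌋₊ + 1 : ℕ) : ℝ) * (1 / ((j : ℝ) + 1))

lemma lt_gridNext (j : ℕ) (r : ℝ) : r < gridNext j r := by
  have hj : (0 : ℝ) < j + 1 := by positivity
  have := Nat.lt_floor_add_one (r * ((j : ℝ) + 1))
  rw [gridNext, mul_one_div, lt_div_iff₀ hj]
  exact_mod_cast this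

lemma gridNext_le (j : ℕ) {r : ℝ} (hr : 0 ≤ r) : gridNext j r ≤ r + 1 / ((j : ℝ) + 1) := by
  have hj : (0 : ℝ) < j + 1 := by positivity
  have := Nat.floor_le (mul_nonneg hr hj.le)
  rw [gridNext, mul_one_div, div_le_iff₀ hj, add_mul, one_div, inv_mul_cancel₀ hj.ne']
  push_cast
  linarith

lemma tendsto_gridNext {r : ℝ} (hr : 0 ≤ r) :
    Tendsto (fun j => gridNext j r) atTop (nhds r) := by
  refine tendsto_of_tendsto_of_tendsto_of_le_of_le tendsto_const_nhds ?_
    (fun j => (lt_gridNext j r).le) (fun j => gridNext_le j hr)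
  simpa using tendsto_const_nhds.add (tendsto_one_div_add_atTop_nhds_zero_nat (𝕜 := ℝ))

section Path

variable {f : ℝ → ℝ}

lemma tendsto_comp_gridNext {t r : ℝ} (hf : ContinuousWithinAt f (Ici (t + r)) (t + r))
    (hr : 0 ≤ r) : Tendsto (fun j => f (t + gridNext j r)) atTop (nhds (f (t + r))) := by
  refine hf.tendsto.comp (tendsto_nhdsWithin_iff.2 ⟨?_, ?_⟩)
  · exact tendsto_const_nhds.add (tendsto_gridNext hr)
  · filter_upwards with j
    simpa using (lt_gridNext j r).le

lemma bddAbove_tail (hb : BddAbove (f '' Ici 0)) {t : ℝ} (ht : 0 ≤ t) :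
    BddAbove (f '' Ici t) :=
  hb.mono (image_mono (Ici_subset_Ici.2 ht))

lemma le_tailSup (hb : BddAbove (f '' Ici 0)) {t u : ℝ} (ht : 0 ≤ t) (hu : t ≤ u) :
    f u ≤ tailSup f t :=
  le_csSup (bddAbove_tail hb ht) ⟨u, hu, rfl⟩

lemma tailSup_le {t B : ℝ} (h : ∀ u, t ≤ u → f u ≤ B) : tailSup f t ≤ B :=
  csSup_le (nonempty_Ici.image f) (by rintro _ ⟨u, hu, rfl⟩; exact h u hu)

lemma exists_lt_of_lt_tailSup {t a : ℝ} (h : a < tailSup f t) : ∃ u, t ≤ u ∧ a < f u := by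
  by_contra! hc
  exact absurd (tailSup_le hc) (not_le.2 h)

lemma tailSup_anti (hb : BddAbove (f '' Ici 0)) {s t : ℝ} (hs : 0 ≤ s) (hst : s ≤ t) :
    tailSup f t ≤ tailSup f s :=
  tailSup_le fun _ hu => le_tailSup hb hs (hst.trans hu)

lemma tendsto_tailSup_gridNext (hf : ∀ t, 0 ≤ t → ContinuousWithinAt f (Ici t) t)
    (hb : BddAbove (f '' Ici 0)) {r : ℝ} (hr : 0 ≤ r) :
    Tendsto (fun j => tailSup f (gridNext j r)) atTop (nhds (tailSup f r)) := by
  refine tendsto_order.2 ⟨fun a ha => ?_, fun a ha => ?_⟩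
  · obtain ⟨u, hu, hau⟩ := exists_lt_of_lt_tailSup ha
    have h := tendsto_comp_gridNext (t := r) (r := u - r) (by simpa using hf u (hr.trans hu))
      (sub_nonneg.2 hu)
    rw [add_sub_cancel] at h
    obtain ⟨i, hi⟩ := (h.eventually_const_lt hau).exists
    have hlt : r < r + gridNext i (u - r) := by
      have := lt_gridNext i (u - r)
      linarith
    filter_upwards [(tendsto_gridNext hr).eventually_lt_const hlt] with j hj
    exact hi.trans_le (le_tailSup hb (hr.trans (lt_gridNext j r).le) hj.le)
  · filter_upwards with j
    exact (tailSup_anti hb hr (lt_gridNext j r).le).trans_lt ha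

lemma gridMax_nonneg (h : ℝ) (n : ℕ) (t : ℝ) : 0 ≤ gridMax f h n t := by
  cases n with
  | zero => exact le_rfl
  | succ n => exact le_max_left _ _

lemma gridMax_le (hb : BddAbove (f '' Ici 0)) {h : ℝ} (hh : 0 ≤ h) (n : ℕ) {t : ℝ}
    (ht : 0 ≤ t) : gridMax f h n t ≤ tailSup f t - f t := by
  induction n generalizing t with
  | zero => exact sub_nonneg.2 (le_tailSup hb ht le_rfl)
  | succ n ih =>
    refine max_le (sub_nonneg.2 (le_tailSup hb ht le_rfl)) ?_
    have h1 := ih (add_nonneg ht hh)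
    have h2 := tailSup_anti hb ht (le_add_of_nonneg_right hh : t ≤ t + h)
    linarith

lemma sub_le_gridMax (h : ℝ) {n k : ℕ} (hk : k ≤ n) (t : ℝ) :
    f (t + k * h) - f t ≤ gridMax f h n t := by
  induction n generalizing t k with
  | zero => simp [Nat.le_zero.1 hk, gridMax]
  | succ n ih =>
    cases k with
    | zero => simpa using gridMax_nonneg h (n + 1) t
    | succ k =>
      refine le_trans ?_ (le_max_right _ _)
      have h1 := ih (Nat.le_of_succ_le_succ hk) (t + h)
      have h2 : t + h + k * h = t + (k + 1 : ℕ) * h := by push_cast; ring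
      rw [h2] at h1
      linarith

lemma tendsto_gridMax (hf : ∀ t, 0 ≤ t → ContinuousWithinAt f (Ici t) t)
    (hb : BddAbove (f '' Ici 0)) {t : ℝ} (ht : 0 ≤ t) :
    Tendsto (fun j : ℕ => gridMax f (1 / ((j : ℝ) + 1)) ((j + 1) ^ 2) t) atTop
      (nhds (tailSup f t - f t)) := by
  refine tendsto_order.2 ⟨fun a ha => ?_, fun a ha => ?_⟩
  · obtain ⟨u, hu, hau⟩ := exists_lt_of_lt_tailSup (lt_sub_iff_add_lt.1 ha)
    have h := tendsto_comp_gridNext (t := t) (r := u - t) (by simpa using hf u (ht.trans hu))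
      (sub_nonneg.2 hu)
    rw [add_sub_cancel] at h
    filter_upwards [h.eventually_const_lt hau, eventually_ge_atTop ⌈u - t⌉₊] with j hj hju
    have hju' : u - t ≤ j := Nat.ceil_le.1 hju
    have hk : ⌊(u - t) * ((j : ℝ) + 1)⌋₊ + 1 ≤ (j + 1) ^ 2 := by
      have h1 := Nat.floor_le (mul_nonneg (sub_nonneg.2 hu) (by positivity : (0 : ℝ) ≤ j + 1))
      have h2 : ((⌊(u - t) * ((j : ℝ) + 1)⌋₊ + 1 : ℕ) : ℝ) ≤ ((j + 1) ^ 2 : ℕ) := by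
        push_cast
        nlinarith [(Nat.cast_nonneg j : (0 : ℝ) ≤ j)]
      exact_mod_cast h2
    have := sub_le_gridMax (f := f) (1 / ((j : ℝ) + 1)) hk t
    rw [gridNext] at hj
    linarith
  · filter_upwards with j
    exact (gridMax_le hb (by positivity) _ ht).trans_lt ha

lemma firstPassage_le {x t : ℝ} (ht : 0 ≤ t) (hx : x < f t) :
    sInf {t | 0 ≤ t ∧ x < f t} ≤ t :=
  csInf_le ⟨0, fun _ hs => hs.1⟩ ⟨ht, hx⟩

lemma le_apply_firstPassage (hf : ∀ t, 0 ≤ t → ContinuousWithinAt f (Ici t) t) {x : ℝ}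
    (hne : ∃ t, 0 ≤ t ∧ x < f t) : x ≤ f (sInf {t | 0 ≤ t ∧ x < f t}) := by
  set r := sInf {t | 0 ≤ t ∧ x < f t}
  have hr : 0 ≤ r := Real.sInf_nonneg fun t ht => ht.1
  by_contra! hlt
  obtain ⟨v, hv, hvs⟩ := mem_nhdsGE_iff_exists_Ico_subset.1 ((hf r hr).eventually_lt_const hlt)
  have : v ≤ r := le_csInf hne fun t ht => by
    by_contra! htv
    have htx : f t < x := hvs (mem_Ico.2 ⟨firstPassage_le ht.1 ht.2, htv⟩)
    exact absurd htx (not_lt.2 ht.2.le)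
  exact absurd this (not_le.2 hv)

lemma tailSup_firstPassage (hf : ∀ t, 0 ≤ t → ContinuousWithinAt f (Ici t) t)
    (hb : BddAbove (f '' Ici 0)) {x : ℝ} (hne : ∃ t, 0 ≤ t ∧ x < f t) :
    tailSup f (sInf {t | 0 ≤ t ∧ x < f t}) = tailSup f 0 := by
  have hr : 0 ≤ sInf {t | 0 ≤ t ∧ x < f t} := Real.sInf_nonneg fun t ht => ht.1
  refine le_antisymm (tailSup_anti hb le_rfl hr) (tailSup_le fun u hu => ?_)
  rcases le_or_gt (sInf {t | 0 ≤ t ∧ x < f t}) u with h | h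
  · exact le_tailSup hb hr h
  · have hux : f u ≤ x := by
      by_contra! hc
      exact absurd (firstPassage_le hu hc) (not_le.2 h)
    exact (hux.trans (le_apply_firstPassage hf hne)).trans (le_tailSup hb hr le_rfl)

lemma lt_tailSup_zero_iff (hb : BddAbove (f '' Ici 0)) {x : ℝ} :
    x < tailSup f 0 ↔ ∃ t, 0 ≤ t ∧ x < f t :=
  ⟨exists_lt_of_lt_tailSup, fun ⟨_, ht, hx⟩ => hx.trans_le (le_tailSup hb le_rfl ht)⟩

lemma exists_rat_passage (hf : ∀ t, 0 ≤ t → ContinuousWithinAt f (Ici t) t) {x s : ℝ} :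
    (∃ t, 0 ≤ t ∧ t < s ∧ x < f t) ↔ ∃ q : ℚ, 0 ≤ (q : ℝ) ∧ (q : ℝ) < s ∧ x < f q := by
  refine ⟨fun ⟨t, ht, hts, hxt⟩ => ?_, fun ⟨q, h⟩ => ⟨q, h⟩⟩
  obtain ⟨v, hv, hvs⟩ := mem_nhdsGE_iff_exists_Ico_subset.1 ((hf t ht).eventually_const_lt hxt)
  obtain ⟨q, htq, hq⟩ := exists_rat_btwn (lt_min hv hts)
  have hxq : x < f q := hvs (mem_Ico.2 ⟨htq.le, hq.trans_le (min_le_left _ _)⟩)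
  exact ⟨q, ht.trans htq.le, hq.trans_le (min_le_right _ _), hxq⟩

lemma exists_passage_lt_iff {x s : ℝ} : (∃ t, 0 ≤ t ∧ t < s ∧ x < f t) ↔
    (∃ t, 0 ≤ t ∧ x < f t) ∧ sInf {t | 0 ≤ t ∧ x < f t} < s := by
  constructor
  · rintro ⟨t, ht, hts, hxt⟩
    exact ⟨⟨t, ht, hxt⟩, (firstPassage_le ht hxt).trans_lt hts⟩
  · rintro ⟨hne, hlt⟩
    obtain ⟨t, ⟨ht, hxt⟩, hts⟩ := (csInf_lt_iff ⟨0, fun _ hs => hs.1⟩ hne).1 hlt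
    exact ⟨t, ht, hts, hxt⟩

end Path

/-- Law of the maximum over `0 ≤ k ≤ n` of a random walk with step law `μ` started at `0`. -/
def walkMaxLaw (μ : Measure ℝ) : ℕ → Measure ℝ
  | 0 => Measure.dirac 0
  | n + 1 => (μ.prod (walkMaxLaw μ n)).map fun p => max 0 (p.1 + p.2)

lemma isProbabilityMeasure_walkMaxLaw (μ : Measure ℝ) [IsProbabilityMeasure μ] (n : ℕ) :
    IsProbabilityMeasure (walkMaxLaw μ n) := by
  induction n with
  | zero => exact Measure.dirac.isProbabilityMeasure
  | succ n ih => exact Measure.isProbabilityMeasure_map (by fun_prop)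

/-- `e^{-β (sup_{u ≥ t} X_u - X_t)}` as an extended nonnegative number. -/
def tailFactor (X : ℝ → Ω → ℝ) (β t : ℝ) (ω : Ω) : ℝ≥0∞ :=
  ENNReal.ofReal (Real.exp (-(β * (tailSup (fun s => X s ω) t - X t ω))))

/-- The event that `X` exceeds `x` strictly before time `s`. -/
def passedBefore (X : ℝ → Ω → ℝ) (x s : ℝ) : Set Ω := {ω | ∃ t, 0 ≤ t ∧ t < s ∧ x < X t ω}

lemma mem_passedBefore_diff_iff (X : ℝ → Ω → ℝ) (x : ℝ) (j k : ℕ) (ω : Ω) :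
    ω ∈ passedBefore X x (((k + 1 : ℕ) : ℝ) * (1 / ((j : ℝ) + 1))) \
        passedBefore X x ((k : ℝ) * (1 / ((j : ℝ) + 1))) ↔
      hitsAbove X x ω ∧ k = ⌊tauAbove X x ω * ((j : ℝ) + 1)⌋₊ := by
  have hj : (0 : ℝ) < j + 1 := by positivity
  have hτ : 0 ≤ tauAbove X x ω := Real.sInf_nonneg fun t ht => ht.1
  have hmem (s : ℝ) : ω ∈ passedBefore X x s ↔ hitsAbove X x ω ∧ tauAbove X x ω < s :=
    exists_passage_lt_iff (f := fun s => X s ω)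
  rw [Set.mem_sdiff, hmem, hmem, mul_one_div, mul_one_div, lt_div_iff₀ hj, lt_div_iff₀ hj, eq_comm,
    Nat.floor_eq_iff (mul_nonneg hτ hj.le), ← not_lt]
  push_cast
  tauto

namespace IsLevy

variable [m0 : MeasurableSpace Ω] {P : Measure Ω} {ℱ : Filtration ℝ m0} {X : ℝ → Ω → ℝ}

lemma measurable (hX : IsLevy P ℱ X) {t : ℝ} (ht : 0 ≤ t) : Measurable (X t) :=
  ((hX.adapted t ht).measurable).mono (ℱ.le t) le_rfl

lemma measurable_gridMax (hX : IsLevy P ℱ X) {h : ℝ} (hh : 0 ≤ h) (n : ℕ) {t : ℝ}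
    (ht : 0 ≤ t) : Measurable fun ω => gridMax (fun s => X s ω) h n t := by
  induction n generalizing t with
  | zero => exact measurable_const
  | succ n ih =>
    have h1 := hX.measurable (add_nonneg ht hh)
    have h2 := hX.measurable ht
    have h3 := ih (add_nonneg ht hh)
    exact measurable_const.max ((h1.sub h2).add h3)

/-- Restricted to any event of `ℱ t`, the grid maximum of the increments after `t` has the law
of a random walk maximum, scaled by the mass of the event. -/
lemma map_restrict_gridMax (hX : IsLevy P ℱ X) {h : ℝ} (hh : 0 ≤ h) (n : ℕ) {t : ℝ}
    (ht : 0 ≤ t) {A : Set Ω} (hA : MeasurableSet[ℱ t] A) :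
    (P.restrict A).map (fun ω => gridMax (fun s => X s ω) h n t) =
      P A • walkMaxLaw (P.map (X h)) n := by
  have := hX.isProb
  have : IsProbabilityMeasure (P.map (X h)) :=
    Measure.isProbabilityMeasure_map (hX.measurable hh).aemeasurable
  induction n generalizing t A with
  | zero => simp [gridMax, walkMaxLaw, Measure.map_const]
  | succ n ih =>
    have := isProbabilityMeasure_walkMaxLaw (P.map (X h)) n
    have hth : 0 ≤ t + h := add_nonneg ht hh
    have hle : t ≤ t + h := le_add_of_nonneg_right hh
    set Δ : Ω → ℝ := fun ω => X (t + h) ω - X t ω with hΔ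
    set M : Ω → ℝ := fun ω => gridMax (fun s => X s ω) h n (t + h) with hM
    have hΔF : Measurable[ℱ (t + h)] Δ :=
      (hX.adapted _ hth).measurable.sub ((hX.adapted t ht).measurable.mono (ℱ.mono hle) le_rfl)
    have hΔm : Measurable Δ := hΔF.mono (ℱ.le _) le_rfl
    have hMm : Measurable M := hX.measurable_gridMax hh n hth
    have hprod : (P.restrict A).map (fun ω => (Δ ω, M ω)) =
        P A • (P.map (X h)).prod (walkMaxLaw (P.map (X h)) n) := by
      have hsm : (P.restrict A).map Δ = P A • P.map (X h) := by
        ext B hB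
        have hst := hX.stationary t (t + h) ht hle
        rw [add_sub_cancel_left] at hst
        rw [Measure.map_apply hΔm hB, Measure.restrict_apply (hΔm hB), Measure.smul_apply,
          ← hst, Measure.map_apply hΔm hB, smul_eq_mul, mul_comm]
        exact (Indep_iff _ _ _).1 (hX.indepIncrements t (t + h) ht hle) _ _ ⟨B, hB, rfl⟩ hA
      rw [← Measure.prod_smul_left, ← hsm]
      refine (Measure.prod_eq fun B C hB hC => ?_).symm
      have hAB : MeasurableSet[ℱ (t + h)] (Δ ⁻¹' B ∩ A) :=
        (hΔF hB).inter (ℱ.mono hle _ hA)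
      have := congrArg (fun μ => μ C) (ih hth hAB)
      simp only [Measure.smul_apply, smul_eq_mul] at this
      rw [Measure.map_apply hMm hC, Measure.restrict_apply (hMm hC)] at this
      rw [Measure.map_apply (hΔm.prodMk hMm) (hB.prod hC),
        Measure.restrict_apply ((hΔm.prodMk hMm) (hB.prod hC)),
        Measure.map_apply hΔm hB, Measure.restrict_apply (hΔm hB), ← this]
      congr 1
      ext ω
      simp only [mem_inter_iff, mem_preimage, mem_prod]
      tauto
    have hφ : Measurable fun p : ℝ × ℝ => max 0 (p.1 + p.2) := by fun_prop
    calc (P.restrict A).map (fun ω => gridMax (fun s => X s ω) h (n + 1) t)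
        = ((P.restrict A).map (fun ω => (Δ ω, M ω))).map fun p => max 0 (p.1 + p.2) := by
          rw [Measure.map_map hφ (hΔm.prodMk hMm)]
          rfl
      _ = P A • walkMaxLaw (P.map (X h)) (n + 1) := by
          rw [hprod, Measure.map_smul]
          rfl

lemma tendsto_exp_gridMax (hX : IsLevy P ℱ X)
    (hfin : ∀ᵐ ω ∂P, BddAbove ((fun s => X s ω) '' Set.Ici 0)) (β : ℝ) {t : ℝ} (ht : 0 ≤ t) :
    ∀ᵐ ω ∂P, Tendsto (fun j : ℕ => ENNReal.ofReal (Real.exp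
      (-(β * gridMax (fun s => X s ω) (1 / ((j : ℝ) + 1)) ((j + 1) ^ 2) t)))) atTop
      (nhds (tailFactor X β t ω)) := by
  filter_upwards [hfin] with ω hω
  have := tendsto_gridMax (f := fun s => X s ω) (hX.rightCont ω) hω ht
  exact ((ENNReal.continuous_ofReal.comp Real.continuous_exp).tendsto _).comp
    ((this.const_mul β).neg)

lemma aemeasurable_tailFactor (hX : IsLevy P ℱ X)
    (hfin : ∀ᵐ ω ∂P, BddAbove ((fun s => X s ω) '' Set.Ici 0)) (β : ℝ) {t : ℝ} (ht : 0 ≤ t) :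
    AEMeasurable (tailFactor X β t) P := by
  refine aemeasurable_of_tendsto_metrizable_ae' (fun j => ?_) (hX.tendsto_exp_gridMax hfin β ht)
  have := hX.measurable_gridMax (h := 1 / ((j : ℝ) + 1)) (by positivity) ((j + 1) ^ 2) ht
  exact (((this.const_mul β).neg.exp).ennreal_ofReal).aemeasurable

/-- On events of `ℱ t`, the factor `e^{-β (sup_{u ≥ t} X_u - X_t)}` integrates to the mass of
the event times a constant that does not depend on `t`. -/
lemma setLIntegral_tailFactor (hX : IsLevy P ℱ X)
    (hfin : ∀ᵐ ω ∂P, BddAbove ((fun s => X s ω) '' Set.Ici 0)) {β : ℝ} (hβ : 0 ≤ β) {t : ℝ}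
    (ht : 0 ≤ t) {A : Set Ω} (hA : MeasurableSet[ℱ t] A) :
    ∫⁻ ω in A, tailFactor X β t ω ∂P = P A * ∫⁻ ω, tailFactor X β 0 ω ∂P := by
  have := hX.isProb
  have hexp : Measurable fun y : ℝ => ENNReal.ofReal (Real.exp (-(β * y))) := by fun_prop
  have key {s : ℝ} (hs : 0 ≤ s) {B : Set Ω} (hB : MeasurableSet[ℱ s] B) :
      Tendsto (fun j : ℕ => P B * ∫⁻ y, ENNReal.ofReal (Real.exp (-(β * y)))
        ∂walkMaxLaw (P.map (X (1 / ((j : ℝ) + 1)))) ((j + 1) ^ 2)) atTop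
        (nhds (∫⁻ ω in B, tailFactor X β s ω ∂P)) := by
    have hgm (j : ℕ) := hX.measurable_gridMax (h := 1 / ((j : ℝ) + 1)) (by positivity)
      ((j + 1) ^ 2) hs
    have heq (j : ℕ) : P B * ∫⁻ y, ENNReal.ofReal (Real.exp (-(β * y)))
        ∂walkMaxLaw (P.map (X (1 / ((j : ℝ) + 1)))) ((j + 1) ^ 2) =
        ∫⁻ ω in B, ENNReal.ofReal (Real.exp
          (-(β * gridMax (fun s => X s ω) (1 / ((j : ℝ) + 1)) ((j + 1) ^ 2) s))) ∂P := by
      rw [← smul_eq_mul, ← lintegral_smul_measure, ← hX.map_restrict_gridMax (by positivity) _ hs hB,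
        lintegral_map hexp (hgm j)]
    simp_rw [heq]
    refine tendsto_lintegral_of_dominated_convergence' (fun _ => 1)
      (fun j => (hexp.comp (hgm j)).aemeasurable) (fun j => ?_) (by simp)
      (ae_restrict_of_ae (hX.tendsto_exp_gridMax hfin β hs))
    filter_upwards with ω
    rw [ENNReal.ofReal_le_one, Real.exp_le_one_iff, neg_nonpos]
    exact mul_nonneg hβ (gridMax_nonneg _ _ _)
  have h0 := key (le_refl (0 : ℝ)) (B := univ) MeasurableSet.univ
  simp only [measure_univ, one_mul, Measure.restrict_univ] at h0
  exact tendsto_nhds_unique (key ht hA)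
    (ENNReal.Tendsto.const_mul h0 (Or.inr (measure_ne_top P A)))

lemma lintegral_mul_tailFactor (hX : IsLevy P ℱ X)
    (hfin : ∀ᵐ ω ∂P, BddAbove ((fun s => X s ω) '' Set.Ici 0)) {β : ℝ} (hβ : 0 ≤ β) {t : ℝ}
    (ht : 0 ≤ t) {F : Ω → ℝ≥0∞} (hF : Measurable[ℱ t] F) :
    ∫⁻ ω, F ω * tailFactor X β t ω ∂P =
      (∫⁻ ω, tailFactor X β 0 ω ∂P) * ∫⁻ ω, F ω ∂P := by
  set c := ∫⁻ ω, tailFactor X β 0 ω ∂P with hc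
  have hG := hX.aemeasurable_tailFactor hfin β ht
  have htrim : (P.withDensity (tailFactor X β t)).trim (ℱ.le t) = (c • P).trim (ℱ.le t) := by
    refine @Measure.ext _ (ℱ t) _ _ fun A hA => ?_
    rw [trim_measurableSet_eq _ hA, trim_measurableSet_eq _ hA,
      withDensity_apply _ (ℱ.le t _ hA), hX.setLIntegral_tailFactor hfin hβ ht hA,
      Measure.smul_apply, smul_eq_mul, mul_comm]
  have h1 := lintegral_withDensity_eq_lintegral_mul₀ hG (hF.mono (ℱ.le t) le_rfl).aemeasurable
  have h2 : ∫⁻ ω, F ω ∂P.withDensity (tailFactor X β t) = ∫⁻ ω, F ω ∂(c • P) := by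
    rw [← lintegral_trim (ℱ.le t) hF, htrim, lintegral_trim (ℱ.le t) hF]
  rw [h1, lintegral_smul_measure, smul_eq_mul] at h2
  rw [← h2]
  exact lintegral_congr fun ω => mul_comm _ _

lemma measurableSet_passedBefore (hX : IsLevy P ℱ X) (x : ℝ) {s t : ℝ} (hst : s ≤ t) :
    MeasurableSet[ℱ t] (passedBefore X x s) := by
  have : passedBefore X x s =
      ⋃ q : {q : ℚ // 0 ≤ (q : ℝ) ∧ (q : ℝ) < s}, {ω | x < X (q : ℚ) ω} := by
    ext ω
    simp only [passedBefore, mem_ofPred_eq, mem_iUnion]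
    rw [exists_rat_passage (f := fun s => X s ω) (hX.rightCont ω)]
    exact ⟨fun ⟨q, h0, h1, h2⟩ => ⟨⟨q, h0, h1⟩, h2⟩, fun ⟨⟨q, h0, h1⟩, h2⟩ => ⟨q, h0, h1, h2⟩⟩
  rw [this]
  exact MeasurableSet.iUnion fun q => ℱ.mono (q.2.2.le.trans hst) _
    ((hX.adapted _ q.2.1).measurable measurableSet_Ioi)

end IsLevy

/-- `G_σ` on `{τ_x^+ < ∞}` and `0` elsewhere, where `σ` is the first point of the grid
`(j + 1)⁻¹ ℕ` strictly after `τ_x^+`. -/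
def gridPassage (X : ℝ → Ω → ℝ) (x : ℝ) (G : ℝ → Ω → ℝ≥0∞) (j : ℕ) (ω : Ω) : ℝ≥0∞ :=
  if hitsAbove X x ω then G (gridNext j (tauAbove X x ω)) ω else 0

lemma gridPassage_eq_tsum (X : ℝ → Ω → ℝ) (x : ℝ) (G : ℝ → Ω → ℝ≥0∞) (j : ℕ) (ω : Ω) :
    gridPassage X x G j ω = ∑' k : ℕ,
      (passedBefore X x (((k + 1 : ℕ) : ℝ) * (1 / ((j : ℝ) + 1))) \
        passedBefore X x ((k : ℝ) * (1 / ((j : ℝ) + 1)))).indicator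
        (G (((k + 1 : ℕ) : ℝ) * (1 / ((j : ℝ) + 1)))) ω := by
  simp only [indicator_apply, mem_passedBefore_diff_iff]
  rw [tsum_eq_single ⌊tauAbove X x ω * ((j : ℝ) + 1)⌋₊ fun k hk => if_neg fun h => hk h.2]
  simp [gridPassage, gridNext]

namespace IsLevy

variable [m0 : MeasurableSpace Ω] {P : Measure Ω} {ℱ : Filtration ℝ m0} {X : ℝ → Ω → ℝ}

lemma aemeasurable_gridPassage (hX : IsLevy P ℱ X) (x : ℝ) {G : ℝ → Ω → ℝ≥0∞}
    (hG : ∀ t, 0 ≤ t → AEMeasurable (G t) P) (j : ℕ) :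
    AEMeasurable (gridPassage X x G j) P := by
  rw [funext (gridPassage_eq_tsum X x G j)]
  refine AEMeasurable.tsum fun k => (hG _ (by positivity)).indicator ?_
  exact (ℱ.le _ _ (hX.measurableSet_passedBefore x le_rfl)).diff
    (ℱ.le _ _ (hX.measurableSet_passedBefore x le_rfl))

/-- Markov property at the grid discretisations of the first passage time. -/
lemma lintegral_gridPassage (hX : IsLevy P ℱ X)
    (hfin : ∀ᵐ ω ∂P, BddAbove ((fun s => X s ω) '' Set.Ici 0)) {β : ℝ} (hβ : 0 ≤ β) (x : ℝ)
    {F : ℝ → ℝ≥0∞} (hF : Measurable F) (j : ℕ) :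
    ∫⁻ ω, gridPassage X x (fun t ω => F (X t ω) * tailFactor X β t ω) j ω ∂P =
      (∫⁻ ω, tailFactor X β 0 ω ∂P) * ∫⁻ ω, gridPassage X x (fun t ω => F (X t ω)) j ω ∂P := by
  set E : ℕ → Set Ω := fun k => passedBefore X x (((k + 1 : ℕ) : ℝ) * (1 / ((j : ℝ) + 1))) \
        passedBefore X x ((k : ℝ) * (1 / ((j : ℝ) + 1))) with hE
  have ht (k : ℕ) : 0 ≤ ((k + 1 : ℕ) : ℝ) * (1 / ((j : ℝ) + 1)) := by positivity
  have hEm (k : ℕ) : MeasurableSet[ℱ (((k + 1 : ℕ) : ℝ) * (1 / ((j : ℝ) + 1)))] (E k) := by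
    refine (hX.measurableSet_passedBefore x le_rfl).diff (hX.measurableSet_passedBefore x ?_)
    gcongr
    simp
  have hFm (k : ℕ) : Measurable[ℱ (((k + 1 : ℕ) : ℝ) * (1 / ((j : ℝ) + 1)))]
      ((E k).indicator fun ω => F (X (((k + 1 : ℕ) : ℝ) * (1 / ((j : ℝ) + 1))) ω)) :=
    (hF.comp (hX.adapted _ (ht k)).measurable).indicator (hEm k)
  have hFm' (k : ℕ) := ((hFm k).mono (ℱ.le _) le_rfl).aemeasurable (μ := P)
  simp only [gridPassage_eq_tsum]
  rw [lintegral_tsum hFm', lintegral_tsum, ← ENNReal.tsum_mul_left]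
  · refine tsum_congr fun k => ?_
    rw [← hX.lintegral_mul_tailFactor hfin hβ (ht k) (hFm k)]
    exact lintegral_congr fun ω => indicator_mul_left _ _ _
  · intro k
    refine AEMeasurable.indicator ?_ (ℱ.le _ _ (hEm k))
    exact (hF.comp (hX.measurable (ht k))).aemeasurable.mul
      (hX.aemeasurable_tailFactor hfin β (ht k))

end IsLevy

lemma tailFactor_le_one {X : ℝ → Ω → ℝ} {β t : ℝ} {ω : Ω} (hβ : 0 ≤ β) (ht : 0 ≤ t)
    (hω : BddAbove ((fun s => X s ω) '' Set.Ici 0)) : tailFactor X β t ω ≤ 1 := by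
  rw [tailFactor, ENNReal.ofReal_le_one, Real.exp_le_one_iff, neg_nonpos]
  exact mul_nonneg hβ (sub_nonneg.2 (le_tailSup hω ht le_rfl))

lemma ofReal_exp_neg_mul_max_le_one {β : ℝ} (hβ : 0 ≤ β) (y : ℝ) :
    ENNReal.ofReal (Real.exp (-(β * max y 0))) ≤ 1 := by
  rw [ENNReal.ofReal_le_one, Real.exp_le_one_iff, neg_nonpos]
  exact mul_nonneg hβ (le_max_right _ _)

lemma gridPassage_le_one {X : ℝ → Ω → ℝ} {x : ℝ} {G : ℝ → Ω → ℝ≥0∞} {j : ℕ} {ω : Ω}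
    (hG : ∀ t, 0 ≤ t → G t ω ≤ 1) : gridPassage X x G j ω ≤ 1 := by
  have hτ : 0 ≤ tauAbove X x ω := Real.sInf_nonneg fun t ht => ht.1
  unfold gridPassage
  split_ifs
  · exact hG _ (hτ.trans (lt_gridNext j _).le)
  · exact zero_le_one

section Limits

variable {X : ℝ → Ω → ℝ} {β x : ℝ} {ω : Ω}

lemma tendsto_gridPassage
    (hr : ∀ t : ℝ, 0 ≤ t → ContinuousWithinAt (fun s => X s ω) (Set.Ici t) t) (hx : 0 ≤ x) :
    Tendsto (fun j => gridPassage X x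
        (fun t ω => ENNReal.ofReal (Real.exp (-(β * max (X t ω) 0)))) j ω) atTop
      (nhds (if hitsAbove X x ω then
        ENNReal.ofReal (Real.exp (-(β * X (tauAbove X x ω) ω))) else 0)) := by
  have hτ : 0 ≤ tauAbove X x ω := Real.sInf_nonneg fun t ht => ht.1
  unfold gridPassage
  split_ifs with h
  · have hpos : 0 ≤ X (tauAbove X x ω) ω := hx.trans (le_apply_firstPassage hr h)
    have h1 := tendsto_comp_gridNext (f := fun s => X s ω) (t := 0)
      (by simpa using hr _ hτ) hτ
    simp only [zero_add] at h1
    have hc : Continuous fun y : ℝ => ENNReal.ofReal (Real.exp (-(β * max y 0))) :=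
      ENNReal.continuous_ofReal.comp (by fun_prop)
    have h2 := (hc.tendsto _).comp h1
    rwa [max_eq_left hpos] at h2
  · exact tendsto_const_nhds

lemma tendsto_gridPassage_mul_tailFactor
    (hr : ∀ t : ℝ, 0 ≤ t → ContinuousWithinAt (fun s => X s ω) (Set.Ici t) t)
    (hb : BddAbove ((fun s => X s ω) '' Set.Ici 0)) (hx : 0 ≤ x) :
    Tendsto (fun j => gridPassage X x (fun t ω =>
        ENNReal.ofReal (Real.exp (-(β * max (X t ω) 0))) * tailFactor X β t ω) j ω) atTop
      (nhds (if x < supAll X ω then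
        ENNReal.ofReal (Real.exp (-(β * supAll X ω))) else 0)) := by
  have hτ : 0 ≤ tauAbove X x ω := Real.sInf_nonneg fun t ht => ht.1
  have hiff : x < supAll X ω ↔ hitsAbove X x ω := lt_tailSup_zero_iff hb
  unfold gridPassage
  simp only [hiff]
  split_ifs with h
  · have hpos : 0 ≤ X (tauAbove X x ω) ω := hx.trans (le_apply_firstPassage hr h)
    have h1 := tendsto_comp_gridNext (f := fun s => X s ω) (t := 0)
      (by simpa using hr _ hτ) hτ
    simp only [zero_add] at h1
    have h2 := tendsto_tailSup_gridNext hr hb hτ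
    have hsup : tailSup (fun s => X s ω) (tauAbove X x ω) = supAll X ω :=
      tailSup_firstPassage hr hb h
    rw [hsup] at h2
    have hc : Continuous fun p : ℝ × ℝ =>
        ENNReal.ofReal (Real.exp (-(β * max p.1 0)) * Real.exp (-(β * (p.2 - p.1)))) :=
      ENNReal.continuous_ofReal.comp (by fun_prop)
    have h3 := (hc.tendsto _).comp (h1.prodMk_nhds h2)
    have h4 : -(β * X (tauAbove X x ω) ω) + -(β * (supAll X ω - X (tauAbove X x ω) ω)) =
        -(β * supAll X ω) := by ring
    simp only [max_eq_left hpos, ← Real.exp_add, h4] at h3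
    refine h3.congr fun j => ?_
    simp only [Function.comp_apply, tailFactor]
    rw [Real.exp_add, ENNReal.ofReal_mul (Real.exp_nonneg _)]
  · exact tendsto_const_nhds

end Limits

lemma integral_ite_exp_eq_toReal [m0 : MeasurableSpace Ω] {P : Measure Ω} {p : Ω → Prop}
    {g : Ω → ℝ}
    (h : AEMeasurable (fun ω => if p ω then ENNReal.ofReal (Real.exp (g ω)) else 0) P) :
    ∫ ω, (if p ω then Real.exp (g ω) else 0) ∂P =
      (∫⁻ ω, (if p ω then ENNReal.ofReal (Real.exp (g ω)) else 0) ∂P).toReal := by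
  rw [← integral_toReal h (ae_of_all _ fun ω => by split_ifs <;> simp)]
  refine integral_congr_ae (ae_of_all _ fun ω => ?_)
  dsimp only
  split_ifs <;> simp [Real.exp_nonneg]

theorem stmt1 [m0 : MeasurableSpace Ω] (P : Measure Ω) (ℱ : Filtration ℝ m0)
    (X : ℝ → Ω → ℝ) (hX : IsLevy P ℱ X)
    (hfin : ∀ᵐ ω ∂P, BddAbove ((fun s => X s ω) '' Set.Ici 0))
    (β x : ℝ) (hβ : 0 ≤ β) (hx : 0 ≤ x) :
    (∫ ω, (if hitsAbove X x ω then Real.exp (-(β * X (tauAbove X x ω) ω)) else 0) ∂P) =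
      (∫ ω, (if x < supAll X ω then Real.exp (-(β * supAll X ω)) else 0) ∂P) /
        (∫ ω, Real.exp (-(β * supAll X ω)) ∂P) := by
  have := hX.isProb
  set F : ℝ → ℝ≥0∞ := fun y => ENNReal.ofReal (Real.exp (-(β * max y 0))) with hF
  have hFm : Measurable F := by fun_prop
  have hA : ∀ j, AEMeasurable (gridPassage X x (fun t ω => F (X t ω) * tailFactor X β t ω) j) P :=
    hX.aemeasurable_gridPassage x fun t ht =>
      (hFm.comp (hX.measurable ht)).aemeasurable.mul (hX.aemeasurable_tailFactor hfin β ht)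
  have hB : ∀ j, AEMeasurable (gridPassage X x (fun t ω => F (X t ω)) j) P :=
    hX.aemeasurable_gridPassage x fun t ht => (hFm.comp (hX.measurable ht)).aemeasurable
  have hAlim : ∀ᵐ ω ∂P, Tendsto
      (fun j => gridPassage X x (fun t ω => F (X t ω) * tailFactor X β t ω) j ω) atTop
      (nhds (if x < supAll X ω then
        ENNReal.ofReal (Real.exp (-(β * supAll X ω))) else 0)) := by
    filter_upwards [hfin] with ω hω
    exact tendsto_gridPassage_mul_tailFactor (hX.rightCont ω) hω hx
  have hBlim : ∀ᵐ ω ∂P, Tendsto (fun j => gridPassage X x (fun t ω => F (X t ω)) j ω) atTop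
      (nhds (if hitsAbove X x ω then
        ENNReal.ofReal (Real.exp (-(β * X (tauAbove X x ω) ω))) else 0)) :=
    ae_of_all _ fun ω => tendsto_gridPassage (hX.rightCont ω) hx
  have hAint := tendsto_lintegral_of_dominated_convergence' (fun _ => 1) hA
    (fun j => by
      filter_upwards [hfin] with ω hω
      exact gridPassage_le_one fun t ht =>
        mul_le_one' (ofReal_exp_neg_mul_max_le_one hβ _) (tailFactor_le_one hβ ht hω))
    (by simp) hAlim
  have hBint := tendsto_lintegral_of_dominated_convergence' (fun _ => 1) hB
    (fun j => ae_of_all _ fun ω => gridPassage_le_one fun t _ =>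
      ofReal_exp_neg_mul_max_le_one hβ _)
    (by simp) hBlim
  have hCeq : ∀ᵐ ω ∂P, tailFactor X β 0 ω = ENNReal.ofReal (Real.exp (-(β * supAll X ω))) := by
    filter_upwards [hX.zero] with ω hω
    rw [tailFactor, hω, sub_zero]
    rfl
  have hCm := (hX.aemeasurable_tailFactor hfin β le_rfl).congr hCeq
  have hCle : ∫⁻ ω, tailFactor X β 0 ω ∂P ≤ 1 := by
    refine (lintegral_mono_ae (g := fun _ => 1) ?_).trans (by simp)
    filter_upwards [hfin] with ω hω using tailFactor_le_one hβ le_rfl hω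
  have hCne : ∫⁻ ω, tailFactor X β 0 ω ∂P ≠ 0 := fun h0 => by
    rw [lintegral_eq_zero_iff' (hX.aemeasurable_tailFactor hfin β le_rfl)] at h0
    obtain ⟨ω, hω⟩ := h0.exists
    exact absurd (ENNReal.ofReal_eq_zero.1 hω) (not_le.2 (Real.exp_pos _))
  simp_rw [hX.lintegral_gridPassage hfin hβ x hFm] at hAint
  have hmain := tendsto_nhds_unique hAint
    (ENNReal.Tendsto.const_mul hBint (Or.inr (hCle.trans_lt ENNReal.one_lt_top).ne))
  have hCint : ∫ ω, Real.exp (-(β * supAll X ω)) ∂P =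
      (∫⁻ ω, tailFactor X β 0 ω ∂P).toReal := by
    rw [lintegral_congr_ae hCeq, ← integral_toReal hCm (ae_of_all _ fun ω => by simp)]
    exact integral_congr_ae (ae_of_all _ fun ω => by simp [Real.exp_nonneg])
  rw [integral_ite_exp_eq_toReal (aemeasurable_of_tendsto_metrizable_ae' hA hAlim),
    integral_ite_exp_eq_toReal (aemeasurable_of_tendsto_metrizable_ae' hB hBlim), hCint, hmain,
    ENNReal.toReal_mul, mul_div_cancel_left₀]
  exact ENNReal.toReal_ne_zero.2 ⟨hCne, (hCle.trans_lt ENNReal.one_lt_top).ne⟩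

end AKLevy
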